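/- arXiv:1812.11805 — 2 statements merged into one kernel-verified Lean document; each statement's English description precedes it below -/
import Mathlib

section
/- For every integer n ≥ 0, the unsigned Stirling number of the first kind satisfies [n+1, 5]/n! = −(1/4)·H_n^{(4)} + (1/3)·H_n^{(3)}·H_n + (1/8)·(H_n^{(2)})² − (1/4)·H_n^{(2)}·H_n² + (1/24)·H_n⁴ in ℚ, where H_n^{(i)} = Σ_{k=1}^{n} 1/k^i and H_n = H_n^{(1)}. -/
/-- Unsigned Stirling numbers of the first kind (Stirling cycle numbers), via the
recurrence `[n+1, k+1] = n·[n, k+1] + [n, k]`. -/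
def stirling1 : ℕ → ℕ → ℕ
  | 0, 0 => 1
  | 0, _ + 1 => 0
  | _ + 1, 0 => 0
  | n + 1, k + 1 => n * stirling1 n (k + 1) + stirling1 n k

/-- Higher order harmonic numbers `H_n^{(i)} = Σ_{k=1}^n 1/k^i`. -/
def harmonicPow (n i : ℕ) : ℚ := ∑ k ∈ Finset.range n, 1 / ((k + 1 : ℚ)) ^ i

theorem harmonicPow_zero_left (i : ℕ) : harmonicPow 0 i = 0 := by
  simp [harmonicPow]

theorem harmonicPow_succ_left (n i : ℕ) :
    harmonicPow (n + 1) i = harmonicPow n i + ((n + 1 : ℚ)⁻¹) ^ i := by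
  simp [harmonicPow, Finset.sum_range_succ]

theorem harmonic_succ_eq_add_inv (n : ℕ) : harmonic (n + 1) = harmonic n + (n + 1 : ℚ)⁻¹ := by
  rw [harmonic_succ]
  push_cast
  rfl

theorem stirling1_one_succ_succ (k : ℕ) : stirling1 1 (k + 2) = 0 := by
  simp [stirling1]

theorem stirling1_succ_div_factorial (n k : ℕ) :
    (stirling1 (n + 2) (k + 1) : ℚ) / ((n + 1).factorial : ℚ) =
      (stirling1 (n + 1) (k + 1) : ℚ) / (n.factorial : ℚ) +
        (n + 1 : ℚ)⁻¹ * ((stirling1 (n + 1) k : ℚ) / (n.factorial : ℚ)) := by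
  have hn : (n + 1 : ℚ) ≠ 0 := by positivity
  have hf : (n.factorial : ℚ) ≠ 0 := by positivity
  rw [show stirling1 (n + 2) (k + 1) =
    (n + 1) * stirling1 (n + 1) (k + 1) + stirling1 (n + 1) k from rfl, Nat.factorial_succ]
  push_cast
  field_simp

theorem stirling1_one_div_factorial (n : ℕ) :
    (stirling1 (n + 1) 1 : ℚ) / (n.factorial : ℚ) = 1 := by
  induction n with
  | zero => simp [stirling1]
  | succ n ih =>
    rw [stirling1_succ_div_factorial, ih, show stirling1 (n + 1) 0 = 0 from rfl]
    simp

theorem stirling1_two_div_factorial (n : ℕ) :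
    (stirling1 (n + 1) 2 : ℚ) / (n.factorial : ℚ) = harmonic n := by
  induction n with
  | zero => simp [stirling1_one_succ_succ]
  | succ n ih =>
    rw [stirling1_succ_div_factorial, ih, stirling1_one_div_factorial, harmonic_succ_eq_add_inv,
      mul_one]

theorem stirling1_three_div_factorial (n : ℕ) :
    (stirling1 (n + 1) 3 : ℚ) / (n.factorial : ℚ) =
      (1 / 2) * (harmonic n) ^ 2 - (1 / 2) * harmonicPow n 2 := by
  induction n with
  | zero => simp [stirling1_one_succ_succ, harmonicPow_zero_left]
  | succ n ih =>
    rw [stirling1_succ_div_factorial, ih, stirling1_two_div_factorial, harmonic_succ_eq_add_inv,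
      harmonicPow_succ_left]
    ring

theorem stirling1_four_div_factorial (n : ℕ) :
    (stirling1 (n + 1) 4 : ℚ) / (n.factorial : ℚ) =
      (1 / 6) * (harmonic n) ^ 3 - (1 / 2) * harmonic n * harmonicPow n 2 +
        (1 / 3) * harmonicPow n 3 := by
  induction n with
  | zero => simp [stirling1_one_succ_succ, harmonicPow_zero_left]
  | succ n ih =>
    rw [stirling1_succ_div_factorial, ih, stirling1_three_div_factorial, harmonic_succ_eq_add_inv]
    simp only [harmonicPow_succ_left]
    generalize (n + 1 : ℚ)⁻¹ = x
    ring

/-- `[n+1, 5]/n! = -(1/4)·H_n^{(4)} + (1/3)·H_n^{(3)}·H_n + (1/8)·(H_n^{(2)})²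
  - (1/4)·H_n^{(2)}·H_n² + (1/24)·H_n⁴`. -/
theorem stirling1_five (n : ℕ) :
    (stirling1 (n + 1) 5 : ℚ) / (n.factorial : ℚ) =
      -(1 / 4) * harmonicPow n 4 + (1 / 3) * harmonicPow n 3 * harmonic n +
        (1 / 8) * (harmonicPow n 2) ^ 2 - (1 / 4) * harmonicPow n 2 * (harmonic n) ^ 2 +
        (1 / 24) * (harmonic n) ^ 4 := by
  induction n with
  | zero => simp [stirling1_one_succ_succ, harmonicPow_zero_left]
  | succ n ih =>
    rw [stirling1_succ_div_factorial, ih, stirling1_four_div_factorial, harmonic_succ_eq_add_inv]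
    simp only [harmonicPow_succ_left]
    generalize (n + 1 : ℚ)⁻¹ = x
    ring
end

section
/- For all integers n ≥ 0 and r ≥ 0, the unsigned Stirling number of the first kind satisfies (1/n!)·[n+1, r+1] = (−1)^r · Σ_{μ} Π_{j≥1} ((−1)^{m_j(μ)} / m_j(μ)!) · (H_n^{(j)}/j)^{m_j(μ)}, where the sum is over all partitions μ of r, m_j(μ) denotes the number of parts of μ equal to j, and H_n^{(j)} = Σ_{k=1}^{n} 1/k^j are the higher order harmonic numbers. -/
/-- The weight `∏ j, c j ^ m_j / m_j!` of a multiset `s` whose multiplicities are `m_j`. -/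
def multisetWeight (c : ℕ → ℚ) (s : Multiset ℕ) : ℚ :=
  ∏ j ∈ s.toFinset, c j ^ s.count j / ((s.count j).factorial : ℚ)

lemma multisetWeight_eq_prod (c : ℕ → ℚ) {s : Multiset ℕ} {T : Finset ℕ} (h : s.toFinset ⊆ T) :
    multisetWeight c s = ∏ j ∈ T, c j ^ s.count j / ((s.count j).factorial : ℚ) := by
  refine Finset.prod_subset h fun j _ hj ↦ ?_
  rw [Multiset.mem_toFinset] at hj
  simp [Multiset.count_eq_zero_of_notMem hj]

lemma count_mul_multisetWeight_cons (c : ℕ → ℚ) (j : ℕ) (s : Multiset ℕ) :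
    ((j ::ₘ s).count j : ℚ) * multisetWeight c (j ::ₘ s) = c j * multisetWeight c s := by
  have hj : j ∈ (j ::ₘ s).toFinset := by simp
  have hs : s.toFinset ⊆ (j ::ₘ s).toFinset := by
    simp [Multiset.toFinset_cons]
  rw [multisetWeight_eq_prod c hs, multisetWeight, ← Finset.mul_prod_erase _ _ hj,
    ← Finset.mul_prod_erase _ _ hj]
  have hprod : ∏ x ∈ (j ::ₘ s).toFinset.erase j,
        c x ^ (j ::ₘ s).count x / (((j ::ₘ s).count x).factorial : ℚ) =
      ∏ x ∈ (j ::ₘ s).toFinset.erase j, c x ^ s.count x / ((s.count x).factorial : ℚ) := by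
    refine Finset.prod_congr rfl fun x hx ↦ ?_
    rw [Multiset.count_cons_of_ne (Finset.ne_of_mem_erase hx)]
  rw [hprod, Multiset.count_cons_self, Nat.factorial_succ, pow_succ]
  push_cast
  field_simp

/-- The sum of the weights of all partitions of `n`. -/
def partitionWeightSum (c : ℕ → ℚ) (n : ℕ) : ℚ :=
  ∑ μ : Nat.Partition n, multisetWeight c μ.parts

lemma sum_count_mul_multisetWeight (c : ℕ → ℚ) {n j : ℕ} (hj1 : 1 ≤ j) (hjn : j ≤ n) :
    ∑ μ : Nat.Partition n, (μ.parts.count j : ℚ) * multisetWeight c μ.parts =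
      c j * partitionWeightSum c (n - j) := by
  have hfilter : ∑ μ : Nat.Partition n, (μ.parts.count j : ℚ) * multisetWeight c μ.parts =
      ∑ μ : {μ : Nat.Partition n // j ∈ μ.parts},
        (μ.1.parts.count j : ℚ) * multisetWeight c μ.1.parts := by
    rw [← Finset.sum_subtype (Finset.univ.filter fun μ : Nat.Partition n ↦ j ∈ μ.parts) (by simp)
      fun μ ↦ (μ.parts.count j : ℚ) * multisetWeight c μ.parts]
    refine (Finset.sum_filter_of_ne fun μ _ hμ ↦ ?_).symm
    by_contra hmem
    exact hμ (by simp [Multiset.count_eq_zero_of_notMem hmem])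
  rw [hfilter, partitionWeightSum, Finset.mul_sum,
    ← (Nat.Partition.partitionWithPartEquiv hj1 hjn).symm.sum_comp]
  refine Finset.sum_congr rfl fun ν _ ↦ ?_
  rw [Nat.Partition.partitionWithPartEquiv_symm_apply_parts, count_mul_multisetWeight_cons]

lemma Nat.Partition.sum_count_mul {n : ℕ} (μ : Nat.Partition n) :
    ∑ i ∈ Finset.range n, μ.parts.count (i + 1) * (i + 1) = n := by
  have hsub : μ.parts.toFinset ⊆ Finset.range (n + 1) := fun j hj ↦ by
    rw [Multiset.mem_toFinset] at hj
    exact Finset.mem_range_succ_iff.mpr (Nat.Partition.le_of_mem_parts hj)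
  conv_rhs => rw [← μ.parts_sum, Finset.sum_multiset_count_of_subset _ _ hsub,
    Finset.sum_range_succ']
  simp

lemma succ_mul_partitionWeightSum (c : ℕ → ℚ) (n : ℕ) :
    ((n : ℚ) + 1) * partitionWeightSum c (n + 1) =
      ∑ i ∈ Finset.range (n + 1), ((i : ℚ) + 1) * c (i + 1) * partitionWeightSum c (n - i) := by
  calc ((n : ℚ) + 1) * partitionWeightSum c (n + 1)
      = ∑ μ : Nat.Partition (n + 1), ∑ i ∈ Finset.range (n + 1),
          ((i : ℚ) + 1) * ((μ.parts.count (i + 1) : ℚ) * multisetWeight c μ.parts) := by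
        rw [partitionWeightSum, Finset.mul_sum]
        refine Finset.sum_congr rfl fun μ _ ↦ ?_
        have h : ((∑ i ∈ Finset.range (n + 1), μ.parts.count (i + 1) * (i + 1) : ℕ) : ℚ) =
          ((n + 1 : ℕ) : ℚ) := congrArg _ μ.sum_count_mul
        push_cast at h
        rw [← h, Finset.sum_mul]
        exact Finset.sum_congr rfl fun i _ ↦ by ring
    _ = _ := by
        rw [Finset.sum_comm]
        refine Finset.sum_congr rfl fun i hi ↦ ?_
        rw [← Finset.mul_sum, sum_count_mul_multisetWeight c (Nat.le_add_left 1 i)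
          (Finset.mem_range.mp hi), Nat.add_sub_add_right, mul_assoc]

lemma stirling1_succ_one (n : ℕ) : stirling1 (n + 1) 1 = n.factorial := by
  induction n with
  | zero => rfl
  | succ n ih =>
    rw [stirling1, ih, stirling1, Nat.factorial_succ, add_zero]

open PowerSeries in
/-- The generating function `∑ r, [n+1, r+1] / n! X ^ r`. -/
noncomputable def stirlingSeries (n : ℕ) : ℚ⟦X⟧ :=
  PowerSeries.mk fun r ↦ (stirling1 (n + 1) (r + 1) : ℚ) / (n.factorial : ℚ)

open PowerSeries in
/-- The generating function `∑ i, (-1) ^ i H_n^{(i+1)} X ^ i`. -/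
noncomputable def harmonicSeries (n : ℕ) : ℚ⟦X⟧ :=
  PowerSeries.mk fun i ↦ (-1) ^ i * harmonicPow n (i + 1)

open PowerSeries in
lemma stirlingSeries_zero : stirlingSeries 0 = 1 := by
  ext (_ | r) <;> simp [stirlingSeries, stirling1, coeff_one]

open PowerSeries in
lemma stirlingSeries_succ (n : ℕ) :
    stirlingSeries (n + 1) = (1 + C (1 / ((n : ℚ) + 1)) * X) * stirlingSeries n := by
  have h0 : ((n.factorial : ℕ) : ℚ) ≠ 0 := by positivity
  have h1 : ((n : ℚ) + 1) ≠ 0 := by positivity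
  ext (_ | r)
  · simp [stirlingSeries, stirling1_succ_one, h0, Nat.factorial_succ, h1]
  · rw [add_mul, one_mul, mul_assoc, map_add, coeff_C_mul, coeff_succ_X_mul]
    simp only [stirlingSeries, coeff_mk]
    rw [stirling1, Nat.factorial_succ]
    push_cast
    field_simp

open PowerSeries in
lemma one_add_mul_harmonicSeries_succ (n : ℕ) :
    (1 + C (1 / ((n : ℚ) + 1)) * X) * harmonicSeries (n + 1) =
      (1 + C (1 / ((n : ℚ) + 1)) * X) * harmonicSeries n + C (1 / ((n : ℚ) + 1)) := by
  have hsucc : harmonicSeries (n + 1) = harmonicSeries n +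
      PowerSeries.mk fun i ↦ (-1 : ℚ) ^ i * (1 / ((n : ℚ) + 1) ^ (i + 1)) := by
    ext i
    simp [harmonicSeries, harmonicPow, Finset.sum_range_succ, mul_add]
  rw [hsucc, mul_add]
  congr 1
  have h1 : ((n : ℚ) + 1) ≠ 0 := by positivity
  ext (_ | r)
  · simp
  · rw [add_mul, one_mul, mul_assoc, map_add, coeff_C_mul, coeff_succ_X_mul, coeff_mk, coeff_mk,
      coeff_C, if_neg r.succ_ne_zero]
    field_simp
    ring

open PowerSeries in
lemma derivative_stirlingSeries (n : ℕ) :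
    d⁄dX ℚ (stirlingSeries n) = stirlingSeries n * harmonicSeries n := by
  induction n with
  | zero =>
    have h : harmonicSeries 0 = 0 := by ext; simp [harmonicSeries, harmonicPow]
    rw [stirlingSeries_zero, h, mul_zero, derivative_one]
  | succ n ih =>
    have h : d⁄dX ℚ (stirlingSeries (n + 1)) =
        (1 + C (1 / ((n : ℚ) + 1)) * X) * d⁄dX ℚ (stirlingSeries n) +
          stirlingSeries n * C (1 / ((n : ℚ) + 1)) := by
      rw [stirlingSeries_succ, Derivation.leibniz, map_add, Derivation.leibniz]
      simp
    rw [h, ih, stirlingSeries_succ]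
    linear_combination -stirlingSeries n * one_add_mul_harmonicSeries_succ n

lemma succ_mul_stirling1_div_factorial (n r : ℕ) :
    ((r : ℚ) + 1) * ((stirling1 (n + 1) (r + 2) : ℚ) / (n.factorial : ℚ)) =
      ∑ i ∈ Finset.range (r + 1), (-1) ^ i * harmonicPow n (i + 1) *
        ((stirling1 (n + 1) (r - i + 1) : ℚ) / (n.factorial : ℚ)) := by
  have h := congrArg (PowerSeries.coeff r) (derivative_stirlingSeries n)
  rw [PowerSeries.coeff_derivative, mul_comm (stirlingSeries n), PowerSeries.coeff_mul,
    Finset.Nat.sum_antidiagonal_eq_sum_range_succ_mk] at h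
  simp only [stirlingSeries, harmonicSeries, PowerSeries.coeff_mk] at h
  rw [mul_comm, h]

lemma stirling1_div_factorial_eq (n r : ℕ) :
    (stirling1 (n + 1) (r + 1) : ℚ) / (n.factorial : ℚ) =
      (-1) ^ r * partitionWeightSum (fun j ↦ -(harmonicPow n j / (j : ℚ))) r := by
  induction r using Nat.strong_induction_on with
  | _ r ih =>
    cases r with
    | zero =>
      have h0 : ((n.factorial : ℕ) : ℚ) ≠ 0 := by positivity
      simp [stirling1_succ_one, h0, partitionWeightSum, multisetWeight]
    | succ r =>
      have hr : ((r : ℚ) + 1) ≠ 0 := by positivity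
      refine mul_left_cancel₀ hr ?_
      rw [succ_mul_stirling1_div_factorial, mul_left_comm, succ_mul_partitionWeightSum,
        Finset.mul_sum]
      refine Finset.sum_congr rfl fun i hi ↦ ?_
      have hir : i ≤ r := Finset.mem_range_succ_iff.mp hi
      have hi0 : ((i : ℚ) + 1) ≠ 0 := by positivity
      have hpow : (-1 : ℚ) ^ r = (-1) ^ i * (-1) ^ (r - i) := by
        rw [← pow_add, Nat.add_sub_cancel' hir]
      rw [ih (r - i) (by omega), pow_succ, hpow]
      push_cast
      field_simp

/-- For all `n, r ≥ 0`:
`(1/n!)·[n+1, r+1] = (-1)^r · Σ_{μ ⊢ r} Π_{j≥1} ((-1)^{m_j(μ)}/m_j(μ)!)·(H_n^{(j)}/j)^{m_j(μ)}`,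
where the sum is over partitions `μ` of `r` and `m_j(μ)` is the multiplicity of the part `j`
in `μ` (every part of a partition of `r` lies in `[1, r]`, so the product may be taken over
`j ∈ [1, r]`). -/
theorem stirling1_eq_partition_sum (n r : ℕ) :
    (stirling1 (n + 1) (r + 1) : ℚ) / (n.factorial : ℚ) =
      (-1 : ℚ) ^ r *
        ∑ μ : Nat.Partition r,
          ∏ j ∈ Finset.Icc 1 r,
            ((-1 : ℚ) ^ (μ.parts.count j) / ((μ.parts.count j).factorial : ℚ)) *
              (harmonicPow n j / (j : ℚ)) ^ (μ.parts.count j) := by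
  rw [stirling1_div_factorial_eq, partitionWeightSum]
  congr 1
  refine Finset.sum_congr rfl fun μ _ ↦ ?_
  have hsub : μ.parts.toFinset ⊆ Finset.Icc 1 r := fun j hj ↦ by
    rw [Multiset.mem_toFinset] at hj
    exact Finset.mem_Icc.mpr ⟨μ.parts_pos hj, Nat.Partition.le_of_mem_parts hj⟩
  rw [multisetWeight_eq_prod _ hsub]
  refine Finset.prod_congr rfl fun j _ ↦ ?_
  rw [neg_pow]
  ring
end
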